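/- arXiv:2306.07862 — 6 statements merged into one kernel-verified Lean document; each statement's English description precedes it below -/
import Mathlib

section
/- Let G = (V,E) be a connected simple graph on at least two vertices. A code C ⊆ V is self-locating-dominating in G if and only if for all vertices u ∈ V \ C and v ∈ V with u ≠ v, the set I(C;u) \ I(C;v) is nonempty. -/
open Set

/-- The closed neighbourhood N[v] of a vertex in a simple graph. -/
def closedNbhd {V : Type*} (G : SimpleGraph V) (v : V) : Set V :=
  insert v (G.neighborSet v)

/-- The identifying set I(C;v) = N[v] ∩ C. -/
def iSet {V : Type*} (G : SimpleGraph V) (C : Set V) (v : V) : Set V :=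
  closedNbhd G v ∩ C

/-- C is a locating-dominating code: for all distinct non-codewords u, v,
    I(C;u) ≠ ∅ and I(C;u) ≠ I(C;v). -/
def IsLocDom {V : Type*} (G : SimpleGraph V) (C : Set V) : Prop :=
  ∀ u ∉ C, ∀ v ∉ C, u ≠ v → (iSet G C u).Nonempty ∧ iSet G C u ≠ iSet G C v

/-- C is a solid-locating-dominating code: for all distinct non-codewords u, v,
    I(C;u) \ I(C;v) ≠ ∅. -/
def IsSolidLocDom {V : Type*} (G : SimpleGraph V) (C : Set V) : Prop :=
  ∀ u ∉ C, ∀ v ∉ C, u ≠ v → (iSet G C u \ iSet G C v).Nonempty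

/-- C is a self-locating-dominating code: for all non-codewords u,
    I(C;u) ≠ ∅ and ⋂_{c ∈ I(C;u)} N[c] = {u}. -/
def IsSelfLocDom {V : Type*} (G : SimpleGraph V) (C : Set V) : Prop :=
  ∀ u ∉ C, (iSet G C u).Nonempty ∧ (⋂ c ∈ iSet G C u, closedNbhd G c) = {u}

lemma mem_closedNbhd_comm {V : Type*} {G : SimpleGraph V} {u v : V} :
    u ∈ closedNbhd G v ↔ v ∈ closedNbhd G u := by
  simp only [closedNbhd, mem_insert_iff, SimpleGraph.mem_neighborSet, eq_comm, G.adj_comm]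

/-- A vertex `v` lies in every `N[c]` with `c ∈ I(C;u)` exactly when `I(C;u) ⊆ I(C;v)`. -/
lemma mem_iInter_closedNbhd_iff {V : Type*} {G : SimpleGraph V} {C : Set V} {u v : V} :
    v ∈ ⋂ c ∈ iSet G C u, closedNbhd G c ↔ iSet G C u ⊆ iSet G C v := by
  rw [mem_iInter₂]
  exact ⟨fun h c hc ↦ ⟨mem_closedNbhd_comm.1 (h c hc), hc.2⟩,
    fun h c hc ↦ mem_closedNbhd_comm.1 (h hc).1⟩

lemma iInter_closedNbhd_subset_singleton_iff {V : Type*} {G : SimpleGraph V} {C : Set V} {u : V} :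
    (⋂ c ∈ iSet G C u, closedNbhd G c) ⊆ {u} ↔
      ∀ v : V, u ≠ v → (iSet G C u \ iSet G C v).Nonempty := by
  refine forall_congr' fun v ↦ ?_
  rw [mem_iInter_closedNbhd_iff, mem_singleton_iff, ← not_imp_not, eq_comm,
    Set.not_subset_iff_exists_mem_notMem]
  rfl

/-- Characterization of self-locating-dominating codes:
    C is self-locating-dominating iff for all distinct u ∈ V \ C and v ∈ V,
    I(C;u) \ I(C;v) ≠ ∅. -/
theorem selfLocDom_characterization {V : Type*} (G : SimpleGraph V)
    (hG : G.Connected) (hV : Nontrivial V) (C : Set V) (hC : C.Nonempty) :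
    IsSelfLocDom G C ↔
      ∀ u ∉ C, ∀ v : V, u ≠ v → (iSet G C u \ iSet G C v).Nonempty := by
  refine forall₂_congr fun u _ ↦ ⟨fun h ↦ ?_, fun h ↦ ?_⟩
  · exact iInter_closedNbhd_subset_singleton_iff.1 h.2.subset
  · obtain ⟨v, hv⟩ := exists_ne u
    refine ⟨(h v hv.symm).mono sdiff_subset, ?_⟩
    refine (iInter_closedNbhd_subset_singleton_iff.2 h).antisymm (singleton_subset_iff.2 ?_)
    exact mem_iInter_closedNbhd_iff.2 subset_rfl
end

section
/- In the infinite triangular grid G, the code C = { v(i,j) : i ≡ 0 (mod 2) and j ≡ 0 (mod 2) } is a self-locating-dominating code, and its density D(C) equals 1/4. -/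
open Set

/-- The square V_n = { (x,y) : |x| ≤ n, |y| ≤ n } of index pairs. -/
def gridBox (n : ℕ) : Set (ℤ × ℤ) := {p | |p.1| ≤ (n : ℤ) ∧ |p.2| ≤ (n : ℤ)}

/-- The density D(C) = limsup_{n→∞} |C ∩ V_n| / |V_n| of a code in an infinite grid
    whose vertices are indexed by ℤ². -/
noncomputable def gridDensity (C : Set (ℤ × ℤ)) : ℝ :=
  Filter.limsup
    (fun n : ℕ => ((C ∩ gridBox n).ncard : ℝ) / ((gridBox n).ncard : ℝ))
    Filter.atTop

/-- The infinite triangular grid: vertices are indexed by (i,j) ∈ ℤ² (the point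
    i(1,0) + j(1/2,√3/2)), and v(i,j), v(i',j') are adjacent iff
    (i−i', j−j') ∈ {±(1,0), ±(0,1), ±(1,−1)}. -/
def triGrid : SimpleGraph (ℤ × ℤ) :=
  SimpleGraph.fromRel (fun u v =>
    (u.1 - v.1, u.2 - v.2) ∈
      ({(1,0), (-1,0), (0,1), (0,-1), (1,-1), (-1,1)} : Set (ℤ × ℤ)))

theorem mem_closedNbhd_triGrid (u v : ℤ × ℤ) :
    v ∈ closedNbhd triGrid u ↔
      |v.1 - u.1| ≤ 1 ∧ |v.2 - u.2| ≤ 1 ∧ |(v.1 + v.2) - (u.1 + u.2)| ≤ 1 := by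
  obtain ⟨a, b⟩ := u
  obtain ⟨c, d⟩ := v
  simp only [closedNbhd, triGrid, Set.mem_insert_iff, SimpleGraph.mem_neighborSet,
    SimpleGraph.fromRel_adj, Set.mem_singleton_iff, Prod.mk.injEq, ne_eq, abs_le]
  omega

theorem isSelfLocDom_triGrid_even :
    IsSelfLocDom triGrid {p : ℤ × ℤ | p.1 % 2 = 0 ∧ p.2 % 2 = 0} := by
  rintro ⟨i, j⟩ hu
  simp only [Set.mem_ofPred_eq] at hu
  -- The two codewords adjacent to a non-codeword are antipodal neighbours of it.
  obtain ⟨a, b, hab, ha, hb⟩ : ∃ a b : ℤ,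
      ((a = 1 ∧ b = 0) ∨ (a = 0 ∧ b = 1) ∨ (a = 1 ∧ b = -1)) ∧
        (i + a) % 2 = 0 ∧ (j + b) % 2 = 0 := by
    rcases Int.emod_two_eq_zero_or_one i with hi | hi
    · exact ⟨0, 1, by omega, by omega, by omega⟩
    · rcases Int.emod_two_eq_zero_or_one j with hj | hj
      · exact ⟨1, 0, by omega, by omega, by omega⟩
      · exact ⟨1, -1, by omega, by omega, by omega⟩
  have hpos : (i + a, j + b) ∈
      iSet triGrid {p : ℤ × ℤ | p.1 % 2 = 0 ∧ p.2 % 2 = 0} (i, j) := by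
    refine ⟨?_, ha, hb⟩
    simp only [mem_closedNbhd_triGrid, abs_le]
    omega
  have hneg : (i - a, j - b) ∈
      iSet triGrid {p : ℤ × ℤ | p.1 % 2 = 0 ∧ p.2 % 2 = 0} (i, j) := by
    refine ⟨?_, by dsimp only; omega, by dsimp only; omega⟩
    simp only [mem_closedNbhd_triGrid, abs_le]
    omega
  refine ⟨⟨_, hpos⟩, Set.Subset.antisymm ?_ ?_⟩
  · rintro ⟨k, l⟩ hkl
    rw [Set.mem_iInter₂] at hkl
    have h₁ := hkl _ hpos
    have h₂ := hkl _ hneg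
    simp only [mem_closedNbhd_triGrid, abs_le] at h₁ h₂
    simp only [Set.mem_singleton_iff, Prod.mk.injEq]
    omega
  · rintro _ rfl
    rw [Set.mem_iInter₂]
    rintro c ⟨hc, -⟩
    simp only [mem_closedNbhd_triGrid, abs_le] at hc ⊢
    omega

theorem ncard_gridBox (n : ℕ) : (gridBox n).ncard = (2 * n + 1) ^ 2 := by
  have h : gridBox n = ↑(Finset.Icc (-(n : ℤ)) n ×ˢ Finset.Icc (-(n : ℤ)) n) := by
    ext ⟨i, j⟩
    simp [gridBox, abs_le]
    tauto
  rw [h, Set.ncard_coe_finset, Finset.card_product, Int.card_Icc, sq]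
  congr 1 <;> omega

theorem ncard_even_inter_gridBox (n : ℕ) :
    ({p : ℤ × ℤ | p.1 % 2 = 0 ∧ p.2 % 2 = 0} ∩ gridBox n).ncard =
      (2 * (n / 2) + 1) ^ 2 := by
  have h : {p : ℤ × ℤ | p.1 % 2 = 0 ∧ p.2 % 2 = 0} ∩ gridBox n =
      (fun p : ℤ × ℤ => (2 * p.1, 2 * p.2)) '' gridBox (n / 2) := by
    ext ⟨i, j⟩
    simp only [gridBox, abs_le, Set.mem_inter_iff, Set.mem_ofPred_eq, Set.mem_image,
      Prod.mk.injEq, Prod.exists]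
    constructor
    · intro h
      exact ⟨i / 2, j / 2, by omega, by omega, by omega⟩
    · rintro ⟨a, b, hab, rfl, rfl⟩
      omega
  rw [h, Set.ncard_image_of_injective, ncard_gridBox]
  rintro ⟨a, b⟩ ⟨c, d⟩ hcd
  simp only [Prod.mk.injEq] at hcd ⊢
  omega

theorem tendsto_two_mul_half_add_one_div :
    Filter.Tendsto (fun n : ℕ => ((2 * (n / 2) + 1 : ℕ) : ℝ) / ((2 * n + 1 : ℕ) : ℝ))
      Filter.atTop (nhds (1 / 2)) := by
  rw [tendsto_iff_dist_tendsto_zero]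
  refine squeeze_zero (fun _ => dist_nonneg) (fun n => ?_)
    (tendsto_one_div_add_atTop_nhds_zero_nat (𝕜 := ℝ))
  have hlow : (n : ℝ) ≤ 2 * (n / 2 : ℕ) + 1 := by
    exact_mod_cast (by omega : n ≤ 2 * (n / 2) + 1)
  have hupp : (2 * (n / 2 : ℕ) : ℝ) ≤ n := by
    exact_mod_cast (by omega : 2 * (n / 2) ≤ n)
  have hn : (0 : ℝ) ≤ n := n.cast_nonneg
  have hdiff : ((2 * (n / 2) + 1 : ℕ) : ℝ) / ((2 * n + 1 : ℕ) : ℝ) - 1 / 2 =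
      (4 * (n / 2 : ℕ) + 1 - 2 * n) / (2 * (2 * n + 1)) := by
    push_cast
    field_simp
    ring
  rw [Real.dist_eq, hdiff, abs_div, abs_of_pos (by positivity : (0 : ℝ) < 2 * (2 * n + 1)),
    div_le_div_iff₀ (by positivity) (by positivity)]
  have habs : |(4 * (n / 2 : ℕ) + 1 - 2 * n : ℝ)| ≤ 1 := by
    rw [abs_le]
    constructor <;> linarith
  nlinarith

theorem gridDensity_even :
    gridDensity {p : ℤ × ℤ | p.1 % 2 = 0 ∧ p.2 % 2 = 0} = 1 / 4 := by
  refine Filter.Tendsto.limsup_eq ?_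
  convert tendsto_two_mul_half_add_one_div.pow 2 using 2 with n
  · rw [ncard_even_inter_gridBox, ncard_gridBox, div_pow, Nat.cast_pow, Nat.cast_pow]
  · norm_num

/-- In the triangular grid, { v(i,j) : i ≡ 0 (mod 2), j ≡ 0 (mod 2) } is a
    self-locating-dominating code of density 1/4. -/
theorem triGrid_selfLocDom_density :
    IsSelfLocDom triGrid {p : ℤ × ℤ | p.1 % 2 = 0 ∧ p.2 % 2 = 0} ∧
    gridDensity {p : ℤ × ℤ | p.1 % 2 = 0 ∧ p.2 % 2 = 0} = 1 / 4 :=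
  ⟨isSelfLocDom_triGrid_even, gridDensity_even⟩
end

section
/- If C is a solid-locating-dominating code in the infinite triangular grid, then its density satisfies D(C) ≥ 1/4. -/
open Set

/-- The closed neighbourhood of a vertex of the triangular grid, as a finset. -/
def triNbhd (v : ℤ × ℤ) : Finset (ℤ × ℤ) :=
  ({(0, 0), (1, 0), (-1, 0), (0, 1), (0, -1), (1, -1), (-1, 1)} : Finset (ℤ × ℤ)).map
    (addLeftEmbedding v)

theorem mem_triNbhd {u v : ℤ × ℤ} :
    u ∈ triNbhd v ↔ (u.1 - v.1, u.2 - v.2) ∈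
      ({(0, 0), (1, 0), (-1, 0), (0, 1), (0, -1), (1, -1), (-1, 1)} : Finset (ℤ × ℤ)) := by
  obtain ⟨a, b⟩ := u
  obtain ⟨c, d⟩ := v
  simp only [triNbhd, Finset.mem_map, addLeftEmbedding_apply]
  constructor
  · rintro ⟨w, hw, h⟩
    obtain ⟨e, f⟩ := w
    simp only [Prod.mk_add_mk, Prod.mk.injEq] at h
    obtain ⟨rfl, rfl⟩ := h
    simpa using hw
  · exact fun h => ⟨_, h, by simp⟩

theorem card_triNbhd (v : ℤ × ℤ) : (triNbhd v).card = 7 := by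
  rw [triNbhd, Finset.card_map]
  rfl

theorem self_mem_triNbhd (v : ℤ × ℤ) : v ∈ triNbhd v := by
  simp [mem_triNbhd]

theorem triNbhd_comm {u v : ℤ × ℤ} : u ∈ triNbhd v ↔ v ∈ triNbhd u := by
  simp only [mem_triNbhd, Finset.mem_insert, Finset.mem_singleton, Prod.mk.injEq]
  omega

theorem mem_closedNbhd_triGrid_s6 {u v : ℤ × ℤ} :
    u ∈ closedNbhd triGrid v ↔ u ∈ triNbhd v := by
  obtain ⟨a, b⟩ := u
  obtain ⟨c, d⟩ := v
  simp only [closedNbhd, triGrid, mem_triNbhd, mem_insert_iff, SimpleGraph.mem_neighborSet,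
    SimpleGraph.fromRel_adj, Finset.mem_insert, Finset.mem_singleton, mem_singleton_iff,
    Prod.mk.injEq, ne_eq]
  omega

open Classical in
/-- The identifying set of a vertex of the triangular grid, as a finset. -/
noncomputable def triISet (C : Set (ℤ × ℤ)) (v : ℤ × ℤ) : Finset (ℤ × ℤ) :=
  (triNbhd v).filter (· ∈ C)

theorem mem_triISet {C : Set (ℤ × ℤ)} {u v : ℤ × ℤ} :
    u ∈ triISet C v ↔ u ∈ triNbhd v ∧ u ∈ C := by
  simp [triISet]

theorem IsSolidLocDom.not_triISet_subset {C : Set (ℤ × ℤ)} (h : IsSolidLocDom triGrid C)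
    {u v : ℤ × ℤ} (hu : u ∉ C) (hv : v ∉ C) (huv : u ≠ v) :
    ¬ triISet C u ⊆ triISet C v := by
  obtain ⟨x, ⟨hx, hxC⟩, hx'⟩ := h u hu v hv huv
  intro hsub
  have := mem_triISet.1 (hsub (mem_triISet.2 ⟨mem_closedNbhd_triGrid_s6.1 hx, hxC⟩))
  exact hx' ⟨mem_closedNbhd_triGrid_s6.2 this.1, hxC⟩

theorem IsSolidLocDom.triISet_nonempty {C : Set (ℤ × ℤ)} (h : IsSolidLocDom triGrid C)
    (v : ℤ × ℤ) : (triISet C v).Nonempty := by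
  by_contra hne
  rw [Finset.not_nonempty_iff_eq_empty] at hne
  have hnot : ∀ u ∈ triNbhd v, u ∉ C := fun u hu huC => by
    have : u ∈ triISet C v := mem_triISet.2 ⟨hu, huC⟩
    simp [hne] at this
  obtain ⟨u, hu, huv⟩ := Finset.exists_mem_ne (s := triNbhd v) (by simp [card_triNbhd]) v
  exact h.not_triISet_subset (hnot v (self_mem_triNbhd v)) (hnot u hu) huv.symm (by simp [hne])

/-- At most one vertex of the closed neighbourhood of a codeword has an identifying set
with fewer than two elements. -/
theorem IsSolidLocDom.exists_forall_two_le_card {C : Set (ℤ × ℤ)} (h : IsSolidLocDom triGrid C)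
    {c : ℤ × ℤ} (hc : c ∈ C) :
    ∃ x ∈ triNbhd c, ∀ v ∈ triNbhd c, v ≠ x → 2 ≤ (triISet C v).card := by
  by_cases hsmall : ∀ v ∈ triNbhd c, v ≠ c → 2 ≤ (triISet C v).card
  · exact ⟨c, self_mem_triNbhd c, hsmall⟩
  push Not at hsmall
  obtain ⟨u, hu, huc, hcard⟩ := hsmall
  have hcI : ∀ v ∈ triNbhd c, c ∈ triISet C v := fun v hv =>
    mem_triISet.2 ⟨triNbhd_comm.1 hv, hc⟩
  have hI : triISet C u = {c} :=
    (Finset.eq_of_subset_of_card_le (Finset.singleton_subset_iff.2 (hcI u hu))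
      (by rw [Finset.card_singleton]; omega)).symm
  have huC : u ∉ C := fun huC => huc <| by
    have : u ∈ triISet C u := mem_triISet.2 ⟨self_mem_triNbhd u, huC⟩
    simpa [hI] using this
  have hother : ∀ v ∈ triNbhd c, v ≠ u → v ∈ C := fun v hv hvu => by
    by_contra hvC
    exact h.not_triISet_subset huC hvC hvu.symm
      (by rw [hI, Finset.singleton_subset_iff]; exact hcI v hv)
  refine ⟨u, hu, fun v hv hvu => Finset.one_lt_card.2 ⟨c, hcI v hv, ?_⟩⟩
  by_cases hvc : v = c
  · subst hvc
    obtain ⟨w, hw, hwv⟩ := Finset.exists_mem_ne (s := (triNbhd v).erase u)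
      (by rw [Finset.card_erase_of_mem hu, card_triNbhd]; norm_num) v
    obtain ⟨hwu, hw⟩ := Finset.mem_erase.1 hw
    exact ⟨w, mem_triISet.2 ⟨hw, hother w hw hwu⟩, hwv.symm⟩
  · exact ⟨v, mem_triISet.2 ⟨self_mem_triNbhd v, hother v hv hvu⟩, Ne.symm hvc⟩

/-- The share of every codeword is at most `4`. -/
theorem IsSolidLocDom.share_le {C : Set (ℤ × ℤ)} (h : IsSolidLocDom triGrid C)
    {c : ℤ × ℤ} (hc : c ∈ C) :
    ∑ v ∈ triNbhd c, ((triISet C v).card : ℝ)⁻¹ ≤ 4 := by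
  obtain ⟨x, hx, hbig⟩ := h.exists_forall_two_le_card hc
  rw [← Finset.add_sum_erase _ _ hx]
  have hx1 : ((triISet C x).card : ℝ)⁻¹ ≤ 1 :=
    inv_le_one_of_one_le₀ (by exact_mod_cast (h.triISet_nonempty x).card_pos)
  have hrest : ∑ v ∈ (triNbhd c).erase x, ((triISet C v).card : ℝ)⁻¹ ≤
      ((triNbhd c).erase x).card • (2 : ℝ)⁻¹ := by
    refine Finset.sum_le_card_nsmul _ _ _ fun v hv => ?_
    obtain ⟨hvx, hv⟩ := Finset.mem_erase.1 hv
    exact inv_anti₀ two_pos (by exact_mod_cast hbig v hv hvx)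
  rw [Finset.card_erase_of_mem hx, card_triNbhd] at hrest
  norm_num at hrest
  linarith

/-- Double counting over a finite set `A` of vertices and a finite set `B` containing the
closed neighbourhoods of all vertices of `A`. -/
theorem IsSolidLocDom.card_le {C : Set (ℤ × ℤ)} (h : IsSolidLocDom triGrid C)
    {A B : Finset (ℤ × ℤ)} (hAB : ∀ v ∈ A, triNbhd v ⊆ B) :
    (A.card : ℝ) ≤ 4 * (C ∩ B).ncard := by
  classical
  have hB : (C ∩ B).ncard = (B.filter (· ∈ C)).card := by
    rw [← Set.ncard_coe_finset]
    congr 1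
    ext x
    simp [and_comm]
  calc (A.card : ℝ)
      = ∑ v ∈ A, ∑ _c ∈ triISet C v, ((triISet C v).card : ℝ)⁻¹ := by
        rw [Finset.card_eq_sum_ones, Nat.cast_sum]
        refine Finset.sum_congr rfl fun v _ => ?_
        have : ((triISet C v).card : ℝ) ≠ 0 := by
          exact_mod_cast (h.triISet_nonempty v).card_pos.ne'
        simp [this]
    _ = ∑ c ∈ B.filter (· ∈ C), ∑ v ∈ A.filter (· ∈ triNbhd c),
          ((triISet C v).card : ℝ)⁻¹ := by
        refine Finset.sum_comm' fun v c => ?_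
        simp only [mem_triISet, Finset.mem_filter]
        constructor
        · rintro ⟨hv, hc, hcC⟩
          exact ⟨⟨hv, triNbhd_comm.1 hc⟩, hAB v hv hc, hcC⟩
        · rintro ⟨⟨hv, hc⟩, -, hcC⟩
          exact ⟨hv, triNbhd_comm.1 hc, hcC⟩
    _ ≤ ∑ c ∈ B.filter (· ∈ C), 4 := by
        refine Finset.sum_le_sum fun c hc => le_trans ?_ (h.share_le (Finset.mem_filter.1 hc).2)
        exact Finset.sum_le_sum_of_subset_of_nonneg
          (fun v hv => (Finset.mem_filter.1 hv).2) (fun _ _ _ => by positivity)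
    _ = 4 * (C ∩ B).ncard := by
        rw [hB, Finset.sum_const, nsmul_eq_mul, mul_comm]

theorem gridBox_eq_coe (n : ℕ) :
    gridBox n = ↑(Finset.Icc (-(n : ℤ)) n ×ˢ Finset.Icc (-(n : ℤ)) n) := by
  ext p
  rw [Finset.mem_coe, Finset.mem_product, Finset.mem_Icc, Finset.mem_Icc]
  simp [gridBox, abs_le]

theorem card_Icc_product (n : ℕ) :
    (Finset.Icc (-(n : ℤ)) n ×ˢ Finset.Icc (-(n : ℤ)) n).card = (2 * n + 1) ^ 2 := by
  rw [Finset.card_product, Int.card_Icc, sq]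
  congr 1 <;> omega

theorem IsSolidLocDom.le_ncard_inter_gridBox {C : Set (ℤ × ℤ)} (h : IsSolidLocDom triGrid C)
    (n : ℕ) : ((2 * n + 1 : ℝ)) ^ 2 ≤ 4 * (C ∩ gridBox (n + 1)).ncard := by
  have := h.card_le (A := Finset.Icc (-(n : ℤ)) n ×ˢ Finset.Icc (-(n : ℤ)) n)
    (B := Finset.Icc (-((n + 1 : ℕ) : ℤ)) (n + 1 : ℕ) ×ˢ
      Finset.Icc (-((n + 1 : ℕ) : ℤ)) (n + 1 : ℕ)) (fun v hv u hu => by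
        simp only [mem_triNbhd, Finset.mem_insert, Finset.mem_singleton, Prod.mk.injEq,
          Finset.mem_product, Finset.mem_Icc] at hu hv ⊢
        push_cast
        omega)
  rw [card_Icc_product, ← gridBox_eq_coe] at this
  exact_mod_cast this

/-- Any solid-locating-dominating code in the triangular grid has density
    at least 1/4. -/
theorem triGrid_solidLocDom_density_lower_bound (C : Set (ℤ × ℤ))
    (hC : C.Nonempty) (h : IsSolidLocDom triGrid C) :
    1 / 4 ≤ gridDensity C := by
  have hlim : Filter.Tendsto
      (fun n : ℕ => (1 - 2 * (2 * (n : ℝ) + 1)⁻¹) ^ 2 / 4) Filter.atTop (nhds (1 / 4)) := by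
    have h1 : Filter.Tendsto (fun n : ℕ => 2 * (n : ℝ) + 1) Filter.atTop Filter.atTop :=
      Filter.tendsto_atTop_add_const_right _ _
        (tendsto_natCast_atTop_atTop.const_mul_atTop two_pos)
    simpa using (((h1.inv_tendsto_atTop.const_mul 2).const_sub 1).pow 2).div_const 4
  rw [gridDensity, ← hlim.limsup_eq]
  refine Filter.limsup_le_limsup ?_ hlim.isBoundedUnder_ge.isCoboundedUnder_le
    (Filter.isBoundedUnder_of ⟨1, fun n => ?_⟩)
  · filter_upwards [Filter.eventually_ge_atTop 1] with n hn
    obtain ⟨m, rfl⟩ := Nat.exists_eq_add_of_le' hn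
    have hm := h.le_ncard_inter_gridBox m
    rw [ncard_gridBox, le_div_iff₀ (by positivity)]
    push_cast
    have hpos : (2 * ((m : ℝ) + 1) + 1) ≠ 0 := by positivity
    have heq : (1 - 2 * (2 * ((m : ℝ) + 1) + 1)⁻¹) ^ 2 / 4 * (2 * ((m : ℝ) + 1) + 1) ^ 2 =
        (2 * (m : ℝ) + 1) ^ 2 / 4 := by
      field_simp
      ring
    rw [heq]
    linarith
  · refine div_le_one_of_le₀ ?_ (by positivity)
    have hfin : (gridBox n).Finite := by
      rw [gridBox_eq_coe]
      exact Finset.finite_toSet _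
    exact_mod_cast Set.ncard_le_ncard Set.inter_subset_right hfin
end

section
/- In the infinite king grid G, the code C = { (x,y) ∈ ℤ² : |x| + |y| ≡ 0 (mod 3) } is a solid-locating-dominating code, and its density D(C) equals 1/3. -/
open Set

/-- The infinite king grid: vertex set ℤ², distinct vertices (v₁,v₂), (u₁,u₂)
    adjacent iff |v₁−u₁| ≤ 1 and |v₂−u₂| ≤ 1. -/
def kingGrid : SimpleGraph (ℤ × ℤ) :=
  SimpleGraph.fromRel (fun u v => |u.1 - v.1| ≤ 1 ∧ |u.2 - v.2| ≤ 1)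

theorem mem_closedNbhd_kingGrid {u c : ℤ × ℤ} :
    c ∈ closedNbhd kingGrid u ↔
      c.1 - u.1 ≤ 1 ∧ u.1 - c.1 ≤ 1 ∧ c.2 - u.2 ≤ 1 ∧ u.2 - c.2 ≤ 1 := by
  simp only [closedNbhd, kingGrid, mem_insert_iff, SimpleGraph.mem_neighborSet,
    SimpleGraph.fromRel_adj, abs_le, Prod.ext_iff, ne_eq]
  omega

/-- Every integer has a direction `e = ±1` leading away from the origin. -/
theorem exists_abs_add_eq_abs_add_one (t : ℤ) :
    ∃ e : ℤ, (e = 1 ∨ e = -1) ∧ |t + e| = |t| + 1 ∧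
      (t = 0 ∧ |t| = 0 ∧ |t - e| = 1 ∨ t ≠ 0 ∧ |t - e| = |t| - 1) := by
  rcases lt_trichotomy t 0 with ht | rfl | ht
  · refine ⟨-1, .inr rfl, ?_, .inr ⟨ht.ne, ?_⟩⟩ <;>
      rw [abs_of_nonpos (by omega), abs_of_neg ht] <;> omega
  · exact ⟨1, by simp⟩
  · refine ⟨1, .inl rfl, ?_, .inr ⟨ht.ne', ?_⟩⟩ <;>
      rw [abs_of_nonneg (by omega), abs_of_pos ht]

/-- A non-codeword `(x, y)` is the only non-codeword lying in the closed neighbourhoods of all the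
codewords in its own closed neighbourhood. -/
theorem eq_of_forall_codeword_near {x y z w : ℤ} (hxy : ¬ (|x| + |y|) % 3 = 0)
    (hzw : ¬ (|z| + |w|) % 3 = 0)
    (h : ∀ a b : ℤ, a - x ≤ 1 ∧ x - a ≤ 1 ∧ b - y ≤ 1 ∧ y - b ≤ 1 → (|a| + |b|) % 3 = 0 →
      a - z ≤ 1 ∧ z - a ≤ 1 ∧ b - w ≤ 1 ∧ w - b ≤ 1) :
    x = z ∧ y = w := by
  obtain ⟨e, he, ex, hx⟩ := exists_abs_add_eq_abs_add_one x
  obtain ⟨f, hf, fy, hy⟩ := exists_abs_add_eq_abs_add_one y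
  obtain hr | hr : (|x| + |y|) % 3 = 1 ∨ (|x| + |y|) % 3 = 2 := by omega
  · have h₁ := h (x + e) (y + f) (by omega) (by omega)
    rcases hx with ⟨hx₀, hx₁, hx₂⟩ | ⟨hx₀, hx₂⟩
    · have h₂ := h (x - e) (y + f) (by omega) (by omega)
      have h₃ := h x (y - f) (by omega) (by omega)
      omega
    · have h₂ := h (x - e) y (by omega) (by omega)
      rcases hy with ⟨hy₀, hy₁, hy₂⟩ | ⟨hy₀, hy₂⟩
      · have h₃ := h (x + e) (y - f) (by omega) (by omega)
        omega
      · have h₃ := h x (y - f) (by omega) (by omega)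
        omega
  · have h₁ := h (x + e) y (by omega) (by omega)
    have h₂ := h x (y + f) (by omega) (by omega)
    rcases hx with ⟨hx₀, hx₁, hx₂⟩ | ⟨hx₀, hx₂⟩
    · have h₃ := h (x - e) y (by omega) (by omega)
      obtain rfl : x = z := by omega
      obtain rfl | rfl : y = w ∨ w = y + f := by omega
      · exact ⟨rfl, rfl⟩
      · omega
    · rcases hy with ⟨hy₀, hy₁, hy₂⟩ | ⟨hy₀, hy₂⟩
      · have h₃ := h x (y - f) (by omega) (by omega)
        obtain rfl : y = w := by omega
        obtain rfl | rfl : x = z ∨ z = x + e := by omega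
        · exact ⟨rfl, rfl⟩
        · omega
      · have h₃ := h (x - e) (y - f) (by omega) (by omega)
        omega

theorem isSolidLocDom_kingGrid :
    IsSolidLocDom kingGrid {p : ℤ × ℤ | (|p.1| + |p.2|) % 3 = 0} := by
  rintro ⟨x, y⟩ hu ⟨z, w⟩ hv huv
  by_contra hne
  refine huv (Prod.ext_iff.2 (eq_of_forall_codeword_near hu hv fun a b hab hC => ?_))
  by_contra hn
  exact hne ⟨(a, b), ⟨mem_closedNbhd_kingGrid.2 hab, hC⟩,
    fun hmem => hn (mem_closedNbhd_kingGrid.1 hmem.1)⟩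

theorem Icc_neg_succ_eq_insert (n : ℕ) :
    Finset.Icc (-((n + 1 : ℕ) : ℤ)) ((n + 1 : ℕ) : ℤ) =
      insert (-((n : ℤ) + 1)) (insert ((n : ℤ) + 1) (Finset.Icc (-(n : ℤ)) n)) := by
  ext y
  simp only [Finset.mem_insert, Finset.mem_Icc]
  omega

theorem card_filter_abs_add_mod_three (a : ℤ) (n : ℕ) :
    (((Finset.Icc (-(n : ℤ)) n).filter fun y => (a + |y|) % 3 = 0).card : ℤ) =
      2 * ((n + a) / 3 - a / 3) + if a % 3 = 0 then 1 else 0 := by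
  induction n with
  | zero =>
    simp only [Nat.cast_zero, neg_zero, Finset.Icc_self, Finset.filter_singleton, abs_zero]
    split_ifs <;> simp_all
  | succ n ih =>
    have h : |(n : ℤ) + 1| = n + 1 := abs_of_nonneg (by omega)
    rw [Icc_neg_succ_eq_insert, Finset.filter_insert, Finset.filter_insert, abs_neg, h]
    by_cases hd : (a + ((n : ℤ) + 1)) % 3 = 0
    · rw [if_pos hd, if_pos hd, Finset.card_insert_of_notMem, Finset.card_insert_of_notMem]
      · push_cast
        rw [ih]
        omega
      · simp
      · simp only [Finset.mem_insert, Finset.mem_filter, Finset.mem_Icc]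
        omega
    · rw [if_neg hd, if_neg hd, ih]
      push_cast
      omega

theorem abs_three_mul_ncard_inter_gridBox_sub_le (n : ℕ) :
    |3 * (({p : ℤ × ℤ | (|p.1| + |p.2|) % 3 = 0} ∩ gridBox n).ncard : ℤ) -
      (2 * (n : ℤ) + 1) ^ 2| ≤ 6 * (2 * (n : ℤ) + 1) := by
  have hset : {p : ℤ × ℤ | (|p.1| + |p.2|) % 3 = 0} ∩ gridBox n =
      ↑((Finset.Icc (-(n : ℤ)) n ×ˢ Finset.Icc (-(n : ℤ)) n).filter
        fun p => (|p.1| + |p.2|) % 3 = 0) := by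
    rw [gridBox_eq_coe, Finset.coe_filter]
    ext p
    exact and_comm
  have hcard : ((Finset.Icc (-(n : ℤ)) n).card : ℤ) = 2 * n + 1 := by
    rw [Int.card_Icc]
    omega
  have hsum : 3 * (({p : ℤ × ℤ | (|p.1| + |p.2|) % 3 = 0} ∩ gridBox n).ncard : ℤ) -
      (2 * n + 1) ^ 2 = ∑ x ∈ Finset.Icc (-(n : ℤ)) n,
        (3 * (((Finset.Icc (-(n : ℤ)) n).filter fun y => (|x| + |y|) % 3 = 0).card : ℤ) -
          (2 * n + 1)) := by
    rw [Finset.sum_sub_distrib, ← Finset.mul_sum, Finset.sum_const, nsmul_eq_mul, hcard, hset,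
      ncard_coe_finset, Finset.card_filter, Finset.sum_product, sq]
    simp only [Finset.card_filter, Nat.cast_sum]
  rw [hsum]
  refine (Finset.abs_sum_le_sum_abs _ _).trans
    ((Finset.sum_le_card_nsmul _ _ 6 fun x _ => ?_).trans_eq ?_)
  · rw [card_filter_abs_add_mod_three, abs_le]
    omega
  · rw [nsmul_eq_mul, hcard, mul_comm]

theorem gridDensity_abs_add_abs_mod_three :
    gridDensity {p : ℤ × ℤ | (|p.1| + |p.2|) % 3 = 0} = 1 / 3 := by
  refine Filter.Tendsto.limsup_eq ?_
  rw [tendsto_iff_dist_tendsto_zero]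
  have hlim : Filter.Tendsto (fun n : ℕ => 2 * (1 / ((n : ℝ) + 1))) Filter.atTop (nhds 0) := by
    simpa using (tendsto_one_div_add_atTop_nhds_zero_nat (𝕜 := ℝ)).const_mul 2
  refine squeeze_zero (fun _ => dist_nonneg) (fun n => ?_) hlim
  have hb : |3 * (({p : ℤ × ℤ | (|p.1| + |p.2|) % 3 = 0} ∩ gridBox n).ncard : ℝ) -
      (2 * (n : ℝ) + 1) ^ 2| ≤ 6 * (2 * (n : ℝ) + 1) := by
    exact_mod_cast abs_three_mul_ncard_inter_gridBox_sub_le n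
  rw [ncard_gridBox, Real.dist_eq]
  push_cast
  generalize (({p : ℤ × ℤ | (|p.1| + |p.2|) % 3 = 0} ∩ gridBox n).ncard : ℝ) = c at hb ⊢
  have hn : (0 : ℝ) ≤ n := n.cast_nonneg
  have hle : (n : ℝ) + 1 ≤ 2 * n + 1 := by linarith
  have hpos : (0 : ℝ) < n + 1 := by positivity
  generalize (2 * n + 1 : ℝ) = N at hb hle ⊢
  have hN : 0 < N := hpos.trans_le hle
  calc |c / N ^ 2 - 1 / 3| = |(3 * c - N ^ 2) / (3 * N ^ 2)| := by
        congr 1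
        field_simp
    _ = |3 * c - N ^ 2| / (3 * N ^ 2) := by
        rw [abs_div, abs_of_pos (show 0 < 3 * N ^ 2 by positivity)]
    _ ≤ 6 * N / (3 * N ^ 2) := by gcongr
    _ = 2 * (1 / N) := by field_simp; norm_num
    _ ≤ 2 * (1 / (n + 1)) := by gcongr

/-- In the king grid, { (x,y) : |x| + |y| ≡ 0 (mod 3) } is a
    solid-locating-dominating code of density 1/3. -/
theorem kingGrid_solidLocDom_density :
    IsSolidLocDom kingGrid {p : ℤ × ℤ | (|p.1| + |p.2|) % 3 = 0} ∧
    gridDensity {p : ℤ × ℤ | (|p.1| + |p.2|) % 3 = 0} = 1 / 3 := by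
  exact ⟨isSolidLocDom_kingGrid, gridDensity_abs_add_abs_mod_three⟩
end

section
/- If C is a solid-locating-dominating code in the infinite king grid, then its density satisfies D(C) ≥ 1/3. -/
open Set

namespace KingGridStrip

/-- The trace of a code on a column of three vertices, as (top, middle, bottom). -/
abbrev Col := Bool × Bool × Bool

/-- The number of codewords in a column. -/
def count (c : Col) : ℤ := c.1.toNat + c.2.1.toNat + c.2.2.toNat

/-- The column contains no codeword. -/
def empty (c : Col) : Bool := !c.1 && !c.2.1 && !c.2.2

/-- The number of codewords among the two extreme vertices of a column. -/
def share (c : Col) : ℤ := c.1.toNat + c.2.2.toNat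

/-- The only codeword of the column is at its top or at its bottom. -/
def single (c : Col) : Bool := !c.2.1 && (c.1 != c.2.2)

/-- Twice the charge moved leftwards from column `r` to column `q`, for consecutive columns
`p`, `q`, `r`, `s`. -/
def flow (p q r s : Col) : ℤ :=
  if empty q then share r
  else if empty r then -share q
  else (if empty p && single q then 1 else 0) - (if empty s && single r then 1 else 0)

/-- If the middles of the consecutive columns `q`, `r` are not codewords, then the column `p`
next to `q` is nonempty. -/
def horizontalOK (p q r : Col) : Bool :=
  q.2.1 || r.2.1 || !empty p

/-- If the middle of column `q` and a vertex vertically adjacent to it are not codewords, then the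
opposite row has a codeword in one of the consecutive columns `p`, `q`, `r`. -/
def verticalOK (p q r : Col) : Bool :=
  (q.2.1 || q.1 || (p.2.2 || q.2.2 || r.2.2)) && (q.2.1 || q.2.2 || (p.1 || q.1 || r.1))

/-- If the middle of column `q` and an extreme vertex of column `r` are not codewords, then the
former has a codeword in its neighbourhood which is not in that of the latter. -/
def diagonalOK (p q r : Col) : Bool :=
  q.2.1 || ((r.1 || !empty p || q.2.2 || r.2.2) && (r.2.2 || !empty p || q.1 || r.1))

theorem abs_flow_le : ∀ p q r s : Col, |flow p q r s| ≤ 2 := by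
  decide +kernel

theorem flow_sub_flow_le : ∀ q r s : Col, verticalOK q r s →
    horizontalOK q r s → horizontalOK s r q →
    ∀ p, horizontalOK p q r → horizontalOK r q p → diagonalOK p q r → diagonalOK r q p →
    ∀ u, horizontalOK u s r → horizontalOK r s u → diagonalOK u s r → diagonalOK r s u →
      flow p q r s - flow q r s u ≤ 2 * (count r - 1) := by
  decide +kernel

open Classical in
/-- The trace of the code `C` on the column of three vertices centred at `(x, y)`. -/
noncomputable def col (C : Set (ℤ × ℤ)) (y x : ℤ) : Col :=
  (decide ((x, y + 1) ∈ C), decide ((x, y) ∈ C), decide ((x, y - 1) ∈ C))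

theorem mem_closedNbhd_kingGrid {u v : ℤ × ℤ} :
    u ∈ closedNbhd kingGrid v ↔ |u.1 - v.1| ≤ 1 ∧ |u.2 - v.2| ≤ 1 := by
  simp only [closedNbhd, Set.mem_insert_iff, SimpleGraph.mem_neighborSet, kingGrid,
    SimpleGraph.fromRel_adj, abs_le]
  constructor
  · rintro (rfl | h)
    · simp
    · omega
  · intro h
    by_cases huv : u = v
    · exact Or.inl huv
    · exact Or.inr ⟨Ne.symm huv, Or.inr h⟩

/-- A codeword covering `(x, y)` but not the other non-codeword `v`. -/
theorem exists_separating {C : Set (ℤ × ℤ)} (hC : IsSolidLocDom kingGrid C) {x y : ℤ}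
    {v : ℤ × ℤ} (hu : (x, y) ∉ C) (hv : v ∉ C) (huv : (x, y) ≠ v) :
    ∃ a b : ℤ, (a = x - 1 ∨ a = x ∨ a = x + 1) ∧ (b = y - 1 ∨ b = y ∨ b = y + 1) ∧
      (a, b) ∈ C ∧ ¬ ((-1 ≤ a - v.1 ∧ a - v.1 ≤ 1) ∧ (-1 ≤ b - v.2 ∧ b - v.2 ≤ 1)) := by
  obtain ⟨⟨a, b⟩, ⟨h1, h2⟩, h3⟩ := hC _ hu _ hv huv
  rw [mem_closedNbhd_kingGrid, abs_le, abs_le] at h1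
  refine ⟨a, b, by grind, by grind, h2, fun h => h3 ⟨?_, h2⟩⟩
  rw [mem_closedNbhd_kingGrid, abs_le, abs_le]
  exact h

theorem horizontalOK_col {C : Set (ℤ × ℤ)} (hC : IsSolidLocDom kingGrid C) (x y : ℤ)
    {d : ℤ} (hd : d = 1 ∨ d = -1) :
    horizontalOK (col C y (x - d)) (col C y x) (col C y (x + d)) := by
  by_contra h
  simp only [horizontalOK, empty, col, Bool.or_eq_true, Bool.not_eq_true',
    Bool.and_eq_false_iff, Bool.not_eq_false', decide_eq_true_eq] at h
  obtain ⟨a, b, ha, hb, hab, hn⟩ := exists_separating hC (x := x) (y := y) (v := (x + d, y))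
    (by tauto) (by tauto) (by grind)
  grind

theorem verticalOK_col {C : Set (ℤ × ℤ)} (hC : IsSolidLocDom kingGrid C) (x y : ℤ) :
    verticalOK (col C y (x - 1)) (col C y x) (col C y (x + 1)) := by
  by_contra h
  simp only [verticalOK, col, Bool.or_eq_true, Bool.and_eq_true, decide_eq_true_eq,
    not_and_or] at h
  rcases h with h | h
  · obtain ⟨a, b, ha, hb, hab, hn⟩ := exists_separating hC (x := x) (y := y) (v := (x, y + 1))
      (by tauto) (by tauto) (by grind)
    grind
  · obtain ⟨a, b, ha, hb, hab, hn⟩ := exists_separating hC (x := x) (y := y) (v := (x, y - 1))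
      (by tauto) (by tauto) (by grind)
    grind

theorem diagonalOK_col {C : Set (ℤ × ℤ)} (hC : IsSolidLocDom kingGrid C) (x y : ℤ)
    {d : ℤ} (hd : d = 1 ∨ d = -1) :
    diagonalOK (col C y (x - d)) (col C y x) (col C y (x + d)) := by
  by_contra h
  simp only [diagonalOK, empty, col, Bool.or_eq_true, Bool.not_eq_true', Bool.and_eq_true,
    Bool.and_eq_false_iff, Bool.not_eq_false', decide_eq_true_eq, not_or,
    not_and_or] at h
  obtain ⟨h0, h | h⟩ := h
  · obtain ⟨a, b, ha, hb, hab, hn⟩ := exists_separating hC (x := x) (y := y)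
      (v := (x + d, y + 1)) h0 h.1.1.1 (by grind)
    grind
  · obtain ⟨a, b, ha, hb, hab, hn⟩ := exists_separating hC (x := x) (y := y)
      (v := (x + d, y - 1)) h0 h.1.1.1 (by grind)
    grind

/-- The signed flow across the left boundary of the column at `x` in the strip around row `y`. -/
noncomputable def boundaryFlow (C : Set (ℤ × ℤ)) (y x : ℤ) : ℤ :=
  flow (col C y (x - 2)) (col C y (x - 1)) (col C y x) (col C y (x + 1))

theorem boundaryFlow_sub_le {C : Set (ℤ × ℤ)} (hC : IsSolidLocDom kingGrid C) (x y : ℤ) :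
    boundaryFlow C y x - boundaryFlow C y (x + 1) ≤ 2 * (count (col C y x) - 1) := by
  have e1 : x - 1 + 1 = x := by ring
  have e2 : x + 1 - 1 = x := by ring
  have e3 : x - 1 - 1 = x - 2 := by ring
  have e4 : x + 1 + 1 = x + 2 := by ring
  have e5 : x + 1 - 2 = x - 1 := by ring
  have hH (x : ℤ) := horizontalOK_col hC x y (d := 1) (Or.inl rfl)
  have hH' (x : ℤ) := horizontalOK_col hC x y (d := -1) (Or.inr rfl)
  have hD (x : ℤ) := diagonalOK_col hC x y (d := 1) (Or.inl rfl)
  have hD' (x : ℤ) := diagonalOK_col hC x y (d := -1) (Or.inr rfl)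
  simp only [sub_neg_eq_add, ← sub_eq_add_neg] at hH' hD'
  have hL := hH (x - 1)
  have hL' := hH' (x - 1)
  have hDL := hD (x - 1)
  have hDL' := hD' (x - 1)
  have hR := hH (x + 1)
  have hR' := hH' (x + 1)
  have hDR := hD (x + 1)
  have hDR' := hD' (x + 1)
  rw [e1, e3] at hL hL' hDL hDL'
  rw [e2, e4] at hR hR' hDR hDR'
  unfold boundaryFlow
  rw [e2, e4, e5]
  exact flow_sub_flow_le _ _ _ (verticalOK_col hC x y) (hH x) (hH' x) _ hL hL' hDL hDL' _
    hR' hR hDR' hDR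

theorem le_sum_count_col {C : Set (ℤ × ℤ)} (hC : IsSolidLocDom kingGrid C) (a y : ℤ) (N : ℕ) :
    (N : ℤ) - 2 ≤ ∑ k ∈ Finset.range N, count (col C y (a + k)) := by
  have key : boundaryFlow C y a - boundaryFlow C y (a + N) ≤
      2 * (∑ k ∈ Finset.range N, count (col C y (a + k)) - N) := by
    induction N with
    | zero => simp
    | succ N ih =>
      have h := boundaryFlow_sub_le hC (a + N) y
      rw [Finset.sum_range_succ]
      push_cast
      rw [← add_assoc]
      linarith
  have h1 := abs_le.1 (abs_flow_le (col C y (a - 2)) (col C y (a - 1)) (col C y a)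
    (col C y (a + 1)))
  have h2 := abs_le.1 (abs_flow_le (col C y (a + N - 2)) (col C y (a + N - 1))
    (col C y (a + N)) (col C y (a + N + 1)))
  simp only [boundaryFlow] at key
  linarith [h1.1, h2.2]

theorem sum_range_three_le {g : ℕ → ℤ} (hg : ∀ k, 0 ≤ g k) (N : ℕ) :
    ∑ k ∈ Finset.range N, (g (k + 2) + g (k + 1) + g k) ≤
      3 * ∑ k ∈ Finset.range (N + 2), g k := by
  have h1 := Finset.sum_range_succ' g N
  have h2 := Finset.sum_range_succ' g (N + 1)
  have h3 := Finset.sum_range_succ' (fun k => g (k + 1)) N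
  have h4 := Finset.sum_range_succ g (N + 1)
  have h5 := Finset.sum_range_succ g N
  simp only [Finset.sum_add_distrib]
  simp only [add_assoc, Nat.reduceAdd, zero_add] at *
  linarith [hg 0, hg 1, hg N, hg (N + 1)]

theorem sum_Icc_eq_sum_range (g : ℤ → ℤ) (n : ℕ) :
    ∑ x ∈ Finset.Icc (-n : ℤ) n, g x = ∑ k ∈ Finset.range (2 * n + 1), g (-n + k) := by
  symm
  refine Finset.sum_nbij' (fun k : ℕ => (-n + k : ℤ)) (fun x => (x + n).toNat) ?_ ?_ ?_ ?_ ?_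
  · intro k hk
    simp only [Finset.mem_range, Finset.mem_Icc] at *
    omega
  · intro x hx
    simp only [Finset.mem_range, Finset.mem_Icc] at *
    omega
  · intro k hk
    simp
  · intro x hx
    simp only [Finset.mem_Icc] at *
    omega
  · intro k hk
    rfl

theorem gridBox_eq (n : ℕ) :
    gridBox n = ↑(Finset.Icc (-n : ℤ) n ×ˢ Finset.Icc (-n : ℤ) n) := by
  ext p
  simp only [gridBox, abs_le, Set.mem_ofPred_eq, Finset.coe_product, Finset.coe_Icc, Set.mem_prod,
    Set.mem_Icc]

theorem ncard_gridBox (n : ℕ) : (gridBox n).ncard = (2 * n + 1) ^ 2 := by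
  rw [gridBox_eq, Set.ncard_coe_finset, Finset.card_product, Int.card_Icc, sq]
  congr 1 <;> omega

open Classical in
theorem ncard_inter_gridBox (C : Set (ℤ × ℤ)) (n : ℕ) :
    ((C ∩ gridBox n).ncard : ℤ) = ∑ j ∈ Finset.range (2 * n + 1),
      ∑ k ∈ Finset.range (2 * n + 1), if ((-n + k : ℤ), (-n + j : ℤ)) ∈ C then 1 else 0 := by
  have h : C ∩ gridBox n =
      ↑((Finset.Icc (-n : ℤ) n ×ˢ Finset.Icc (-n : ℤ) n).filter (· ∈ C)) := by
    rw [gridBox_eq]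
    ext p
    simp only [Set.mem_inter_iff, Finset.mem_coe, Finset.mem_filter, and_comm]
  rw [h, Set.ncard_coe_finset, Finset.card_filter]
  push_cast
  rw [Finset.sum_product_right, sum_Icc_eq_sum_range]
  exact Finset.sum_congr rfl fun j _ =>
    sum_Icc_eq_sum_range (fun x => if (x, (-n + j : ℤ)) ∈ C then 1 else 0) n

theorem sq_le_three_mul_ncard {C : Set (ℤ × ℤ)} (hC : IsSolidLocDom kingGrid C) (n : ℕ)
    (hn : 1 ≤ n) : (2 * (n : ℤ) - 1) ^ 2 ≤ 3 * ((C ∩ gridBox n).ncard : ℤ) := by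
  classical
  obtain ⟨m, rfl⟩ := Nat.exists_eq_add_of_le' hn
  rw [ncard_inter_gridBox]
  set M := 2 * (m + 1) + 1 with hM
  let g : ℕ → ℤ := fun j => ∑ k ∈ Finset.range M,
    if ((-(m + 1 : ℕ) + k : ℤ), (-(m + 1 : ℕ) + j : ℤ)) ∈ C then 1 else 0
  have hg (j : ℕ) : 0 ≤ g j := Finset.sum_nonneg fun k _ => by split_ifs <;> simp
  have h3 := sum_range_three_le hg (2 * m + 1)
  refine le_trans ?_ h3
  have hrow (j : ℕ) : (2 * m + 1 : ℤ) ≤ g (j + 2) + g (j + 1) + g j := by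
    have h := le_sum_count_col hC (-(m + 1 : ℕ)) (-(m + 1 : ℕ) + (j + 1 : ℕ)) M
    have e : ∑ k ∈ Finset.range M,
        count (col C (-(m + 1 : ℕ) + (j + 1 : ℕ)) (-(m + 1 : ℕ) + k)) =
        g (j + 2) + g (j + 1) + g j := by
      simp only [g, ← Finset.sum_add_distrib]
      refine Finset.sum_congr rfl fun k _ => ?_
      have e1 : (-(m + 1 : ℕ) + (j + 1 : ℕ) : ℤ) + 1 = -(m + 1 : ℕ) + (j + 2 : ℕ) := by
        push_cast; ring
      have e2 : (-(m + 1 : ℕ) + (j + 1 : ℕ) : ℤ) - 1 = -(m + 1 : ℕ) + j := by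
        push_cast; ring
      simp only [count, col, e1, e2, Bool.toNat, Bool.cond_decide]
      push_cast
      rfl
    rw [e] at h
    push_cast [hM] at h
    linarith
  have := Finset.card_nsmul_le_sum (Finset.range (2 * m + 1))
    (fun k => g (k + 2) + g (k + 1) + g k) (2 * m + 1 : ℤ) fun j _ => hrow j
  simp only [Finset.card_range, nsmul_eq_mul] at this
  push_cast at this ⊢
  linarith

end KingGridStrip

/-- Any solid-locating-dominating code in the king grid has density
    at least 1/3. -/
theorem kingGrid_solidLocDom_density_lower_bound (C : Set (ℤ × ℤ))
    (hCne : C.Nonempty) (hC : IsSolidLocDom kingGrid C) :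
    1 / 3 ≤ gridDensity C := by
  have hlim : Filter.Tendsto (fun n : ℕ => (1 / 3 : ℝ) * (1 - 2 * (1 / ((n : ℝ) + 1))) ^ 2)
      Filter.atTop (nhds (1 / 3)) := by
    have h := ((((tendsto_one_div_add_atTop_nhds_zero_nat (𝕜 := ℝ)).const_mul 2).const_sub
      1).pow 2).const_mul (1 / 3)
    simpa using h
  rw [← hlim.limsup_eq]
  refine Filter.limsup_le_limsup ?_ hlim.isCoboundedUnder_le ?_
  · filter_upwards [Filter.eventually_ge_atTop 1] with n hn
    have h := KingGridStrip.sq_le_three_mul_ncard hC n hn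
    have h' : (2 * (n : ℝ) - 1) ^ 2 ≤ 3 * ((C ∩ gridBox n).ncard : ℝ) := by exact_mod_cast h
    have hn' : (1 : ℝ) ≤ n := by exact_mod_cast hn
    rw [KingGridStrip.ncard_gridBox]
    push_cast
    rw [le_div_iff₀ (by positivity)]
    have e : 1 - 2 * (1 / ((n : ℝ) + 1)) = (n - 1) / (n + 1) := by
      field_simp
      ring
    have h1 : (n - 1) / (n + 1) * (2 * n + 1) ≤ 2 * (n : ℝ) - 1 := by
      rw [div_mul_eq_mul_div, div_le_iff₀ (by positivity)]
      nlinarith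
    have h0 : 0 ≤ (n - 1) / (n + 1) * (2 * (n : ℝ) + 1) := by
      have : 0 ≤ (n : ℝ) - 1 := by linarith
      positivity
    have h2 := pow_le_pow_left₀ h0 h1 2
    rw [e, mul_assoc, ← mul_pow]
    linarith
  · refine Filter.isBoundedUnder_of ⟨1, fun n => ?_⟩
    refine div_le_one_of_le₀ ?_ (by positivity)
    have hfin : (gridBox n).Finite := by
      rw [KingGridStrip.gridBox_eq]
      exact Finset.finite_toSet _
    exact_mod_cast Set.ncard_le_ncard Set.inter_subset_right hfin
end

section
/- For every integer q ≥ 2, we have γ^DLD(K_q □ K_q □ K_q) = q². -/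
open Set

/-- γ^LD(G): minimum cardinality of a locating-dominating code in G. -/
noncomputable def gammaLD {V : Type*} (G : SimpleGraph V) : ℕ :=
  sInf {k | ∃ C : Set V, C.Nonempty ∧ IsLocDom G C ∧ C.ncard = k}

/-- γ^DLD(G): minimum cardinality of a solid-locating-dominating code in G. -/
noncomputable def gammaDLD {V : Type*} (G : SimpleGraph V) : ℕ :=
  sInf {k | ∃ C : Set V, C.Nonempty ∧ IsSolidLocDom G C ∧ C.ncard = k}

/-- γ^SLD(G): minimum cardinality of a self-locating-dominating code in G. -/
noncomputable def gammaSLD {V : Type*} (G : SimpleGraph V) : ℕ :=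
  sInf {k | ∃ C : Set V, C.Nonempty ∧ IsSelfLocDom G C ∧ C.ncard = k}

/-- The Hamming graph K_q □ K_q □ K_q. -/
def hammingCube (q : ℕ) : SimpleGraph (Fin q × Fin q × Fin q) :=
  (⊤ : SimpleGraph (Fin q)).boxProd
    ((⊤ : SimpleGraph (Fin q)).boxProd (⊤ : SimpleGraph (Fin q)))

theorem mem_closedNbhd_hammingCube {q : ℕ} {x y z a b c : Fin q} :
    (a, b, c) ∈ closedNbhd (hammingCube q) (x, y, z) ↔
      (a = x ∧ b = y) ∨ (a = x ∧ c = z) ∨ (b = y ∧ c = z) := by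
  simp only [closedNbhd, hammingCube, Set.mem_insert_iff, SimpleGraph.mem_neighborSet,
    SimpleGraph.boxProd_adj, SimpleGraph.top_adj, Prod.mk.injEq]
  grind

theorem isSolidLocDom_latin (q : ℕ) [NeZero q] :
    IsSolidLocDom (hammingCube q)
      (Set.range fun p : Fin q × Fin q => (p.1, p.2, p.1 + p.2)) := by
  rintro ⟨x, y, z⟩ hu ⟨a, b, c⟩ hv huv
  by_contra hne
  have key : ∀ r s : Fin q, (r, s, r + s) ∈ closedNbhd (hammingCube q) (x, y, z) →
      (r, s, r + s) ∈ closedNbhd (hammingCube q) (a, b, c) := fun r s h₁ =>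
    by_contra fun h₂ => hne ⟨(r, s, r + s), ⟨h₁, (r, s), rfl⟩, fun h => h₂ h.1⟩
  have h₁ := key x y
  have h₂ := key x (z - x)
  have h₃ := key (z - y) y
  simp only [mem_closedNbhd_hammingCube, add_sub_cancel, sub_add_cancel] at h₁ h₂ h₃
  have hz : x + y ≠ z := fun h => hu ⟨(x, y), by simp [h]⟩
  have hy : z - x ≠ y := fun h => hz (by rw [← h, add_sub_cancel])
  have hx : z - y ≠ x := fun h => hz (by rw [← h, sub_add_cancel])
  simp only [ne_eq, Prod.mk.injEq] at huv
  grind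

/-- In a solid-locating-dominating code, a vertex missing from the code whose codeword neighbours
all lie in `N[v]` forces `v` to be a codeword. -/
theorem IsSolidLocDom.mem_of_forall {V : Type*} {G : SimpleGraph V} {C : Set V}
    (hC : IsSolidLocDom G C) {u v : V} (hu : u ∉ C) (huv : u ≠ v)
    (h : ∀ c ∈ C, c ∈ closedNbhd G u → c ∈ closedNbhd G v) : v ∈ C := by
  by_contra hv
  obtain ⟨c, ⟨hcu, hcC⟩, hcv⟩ := hC u hu v hv huv
  exact hcv ⟨h c hcC hcu, hcC⟩

section Counting

open Classical in
/-- The number of triples satisfying `P` in the plane with first coordinate `x`. -/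
noncomputable def planeCount {q : ℕ} (P : Fin q → Fin q → Fin q → Prop) (x : Fin q) : ℕ :=
  ∑ y, ∑ z, if P x y z then 1 else 0

/-- Interchange the first and third coordinates. -/
def swapOuter {q : ℕ} (P : Fin q → Fin q → Fin q → Prop) : Fin q → Fin q → Fin q → Prop :=
  fun x y z => P z y x

/-- If `P` has no points on the lines through `(x, y, z)` in the first two directions, then it
contains all other points of the line in the third direction. -/
def LongLines {q : ℕ} (P : Fin q → Fin q → Fin q → Prop) : Prop :=
  ∀ x y z, (∀ y', ¬ P x y' z) → (∀ x', ¬ P x' y z) → ∀ z', z' ≠ z → P x y z'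

theorem card_le_sum_add_card_filter {α : Type*} [Fintype α] (f : α → ℕ) :
    Fintype.card α ≤ ∑ a, f a + (Finset.univ.filter fun a => f a = 0).card := by
  rw [Finset.card_filter, ← Finset.sum_add_distrib, Fintype.card_eq_sum_ones]
  refine Finset.sum_le_sum fun a _ => ?_
  split_ifs <;> omega

open Classical in
theorem sum_ite_eq_zero_iff {α : Type*} [Fintype α] (p : α → Prop) :
    (∑ a, if p a then 1 else 0) = 0 ↔ ∀ a, ¬ p a := by
  simp

open Classical in
theorem le_sum_ite_of_forall_ne {q : ℕ} {p : Fin q → Prop} (z : Fin q)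
    (h : ∀ z', z' ≠ z → p z') : q - 1 ≤ ∑ z', if p z' then 1 else 0 := by
  rw [← Finset.card_filter]
  calc q - 1 = (Finset.univ.erase z).card := by simp
    _ ≤ _ := Finset.card_le_card fun z' hz' => by simpa using h z' (Finset.ne_of_mem_erase hz')

variable {q : ℕ} {P : Fin q → Fin q → Fin q → Prop}

theorem exists_empty_line (z : Fin q) (hz : planeCount (swapOuter P) z < q) :
    ∃ y, ∀ x, ¬ P x y z := by
  classical
  have h := card_le_sum_add_card_filter fun y => ∑ x, if P x y z then 1 else 0
  have hz' : (∑ y, ∑ x, if P x y z then 1 else 0) < q := hz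
  rw [Fintype.card_fin] at h
  have hpos : 0 < (Finset.univ.filter fun y => (∑ x, if P x y z then 1 else 0) = 0).card := by
    omega
  obtain ⟨y, hy⟩ := Finset.card_pos.mp hpos
  exact ⟨y, (sum_ite_eq_zero_iff _).mp (Finset.mem_filter.mp hy).2⟩

theorem lt_planeCount (hq : 3 ≤ q) (hP : LongLines P) (hP' : LongLines (swapOuter P))
    {x z : Fin q} (hz : planeCount (swapOuter P) z < q) (hx : ∀ y, ¬ P x y z) :
    q < planeCount P x := by
  classical
  have hlong : ∀ y, (∀ x', ¬ P x' y z) → q - 1 ≤ ∑ z', if P x y z' then 1 else 0 :=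
    fun y hy => le_sum_ite_of_forall_ne z (hP x y z hx hy)
  by_cases hne : ∃ y₁, ∀ z', ¬ P x y₁ z'
  · obtain ⟨y₁, hy₁⟩ := hne
    have hline : q - 1 ≤ ∑ x', if P x' y₁ z then 1 else 0 :=
      le_sum_ite_of_forall_ne x (hP' z y₁ x hx hy₁)
    have hempty : ∀ y, y ≠ y₁ → ∀ x', ¬ P x' y z := by
      intro y hy
      rw [← sum_ite_eq_zero_iff]
      have hz' : (∑ y, ∑ x, if P x y z then 1 else 0) < q := hz
      have := Finset.add_le_sum (f := fun y => ∑ x, if P x y z then 1 else 0)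
        (s := Finset.univ) (fun _ _ => Nat.zero_le _) (Finset.mem_univ y) (Finset.mem_univ y₁) hy
      omega
    have hsum : ∑ y ∈ Finset.univ.erase y₁, (q - 1) ≤ planeCount P x :=
      (Finset.sum_le_sum fun y hy => hlong y (hempty y (Finset.ne_of_mem_erase hy))).trans
        (Finset.sum_le_sum_of_subset (Finset.erase_subset _ _))
    simp only [Finset.sum_const, Finset.card_erase_of_mem (Finset.mem_univ _), Finset.card_univ,
      Fintype.card_fin, smul_eq_mul] at hsum
    obtain ⟨k, rfl⟩ := Nat.exists_eq_add_of_le' hq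
    simp only [show k + 3 - 1 = k + 2 by omega] at hsum
    nlinarith
  · obtain ⟨y₀, hy₀⟩ := exists_empty_line z hz
    have hpos : ∀ y, 1 ≤ ∑ z', if P x y z' then 1 else 0 := fun y =>
      Nat.one_le_iff_ne_zero.mpr fun h => hne ⟨y, (sum_ite_eq_zero_iff _).mp h⟩
    have hlt : ∑ _y : Fin q, 1 < planeCount P x :=
      Finset.sum_lt_sum (fun y _ => hpos y) ⟨y₀, Finset.mem_univ _, by
        have := hlong y₀ hy₀; omega⟩
    simpa using hlt

theorem sum_deficit_le_sum_excess (hq : 3 ≤ q) (hP : LongLines P)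
    (hP' : LongLines (swapOuter P)) :
    ∑ z, (q - planeCount (swapOuter P) z) ≤ ∑ x, (planeCount P x - q) := by
  classical
  let D : Finset (Fin q) := Finset.univ.filter fun z => planeCount (swapOuter P) z < q
  let A : Fin q → Finset (Fin q) := fun z => Finset.univ.filter fun x => ∀ y, ¬ P x y z
  have hA : ∀ z, q - planeCount (swapOuter P) z ≤ (A z).card := by
    intro z
    have h := card_le_sum_add_card_filter fun x => ∑ y, if P x y z then 1 else 0
    have hcomm : planeCount (swapOuter P) z = ∑ x, ∑ y, if P x y z then 1 else 0 :=
      Finset.sum_comm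
    simp only [sum_ite_eq_zero_iff, Fintype.card_fin] at h
    rw [hcomm]
    exact Nat.sub_le_iff_le_add'.mpr h
  have hdisj : (D : Set (Fin q)).PairwiseDisjoint A := by
    intro z hz z' _ hne
    refine Finset.disjoint_left.mpr fun x hx hx' => ?_
    obtain ⟨y, hy⟩ := exists_empty_line z (Finset.mem_filter.mp hz).2
    exact (Finset.mem_filter.mp hx').2 y
      (hP x y z (Finset.mem_filter.mp hx).2 hy z' hne.symm)
  calc ∑ z, (q - planeCount (swapOuter P) z)
      = ∑ z ∈ D, (q - planeCount (swapOuter P) z) :=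
        (Finset.sum_subset (Finset.subset_univ D) fun z _ hz => by
          simp only [D, Finset.mem_filter, Finset.mem_univ, true_and] at hz; omega).symm
    _ ≤ ∑ z ∈ D, (A z).card := Finset.sum_le_sum fun z _ => hA z
    _ = (D.biUnion A).card := (Finset.card_biUnion hdisj).symm
    _ ≤ (Finset.univ.filter fun x => q < planeCount P x).card := by
        refine Finset.card_le_card fun x hx => ?_
        obtain ⟨z, hz, hxz⟩ := Finset.mem_biUnion.mp hx
        exact Finset.mem_filter.mpr ⟨Finset.mem_univ _, lt_planeCount hq hP hP'
          (Finset.mem_filter.mp hz).2 (Finset.mem_filter.mp hxz).2⟩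
    _ ≤ ∑ x, (planeCount P x - q) := by
        rw [Finset.card_filter]
        refine Finset.sum_le_sum fun x _ => ?_
        split_ifs <;> omega

theorem sq_le_sum_planeCount (hq : 3 ≤ q) (hP : LongLines P) (hP' : LongLines (swapOuter P)) :
    q ^ 2 ≤ ∑ x, planeCount P x := by
  classical
  have h₁ := sum_deficit_le_sum_excess hq hP hP'
  have h₂ := sum_deficit_le_sum_excess (P := swapOuter P) hq hP' hP
  have hbal : ∀ f : Fin q → ℕ, ∑ x, f x + ∑ x, (q - f x) = q ^ 2 + ∑ x, (f x - q) := by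
    intro f
    have hsq : q ^ 2 = ∑ _x : Fin q, q := by simp [sq]
    rw [hsq, ← Finset.sum_add_distrib, ← Finset.sum_add_distrib]
    exact Finset.sum_congr rfl fun x _ => by omega
  have hswap : ∑ z, planeCount (swapOuter P) z = ∑ x, planeCount P x := by
    simp only [planeCount, swapOuter]
    rw [Finset.sum_comm, Finset.sum_comm (f := fun x y => ∑ z, if P x y z then 1 else 0)]
    exact Finset.sum_congr rfl fun y _ => Finset.sum_comm
  have h₃ := hbal (planeCount P)
  have h₄ := hbal (planeCount (swapOuter P))
  change _ ≤ ∑ x, (planeCount (swapOuter P) x - q) at h₂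
  change ∑ z, (q - planeCount P z) ≤ _ at h₂
  omega

end Counting

theorem sq_le_ncard_of_three_le {q : ℕ} (hq : 3 ≤ q) {C : Set (Fin q × Fin q × Fin q)}
    (hC : IsSolidLocDom (hammingCube q) C) : q ^ 2 ≤ C.ncard := by
  classical
  let P : Fin q → Fin q → Fin q → Prop := fun x y z => (x, y, z) ∈ C
  have hP : LongLines P := by
    intro x y z h₁ h₂ z' hz'
    refine hC.mem_of_forall (u := (x, y, z)) (h₁ y) (by simpa using hz'.symm) ?_
    rintro ⟨a, b, c⟩ hc
    simp only [mem_closedNbhd_hammingCube]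
    rintro (h | ⟨rfl, rfl⟩ | ⟨rfl, rfl⟩)
    · exact Or.inl h
    · exact absurd hc (h₁ b)
    · exact absurd hc (h₂ a)
  have hP' : LongLines (swapOuter P) := by
    intro z y x h₁ h₂ x' hx'
    refine hC.mem_of_forall (u := (x, y, z)) (h₁ y) (by simpa using hx'.symm) ?_
    rintro ⟨a, b, c⟩ hc
    simp only [mem_closedNbhd_hammingCube]
    rintro (⟨rfl, rfl⟩ | ⟨rfl, rfl⟩ | h)
    · exact absurd hc (h₂ c)
    · exact absurd hc (h₁ b)
    · exact Or.inr (Or.inr h)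
  have hcard : ∑ x, planeCount P x = C.ncard := by
    rw [Set.ncard_eq_toFinset_card', ← Finset.filter_univ_mem C.toFinset, Finset.card_filter,
      Fintype.sum_prod_type]
    simp only [planeCount, P, Fintype.sum_prod_type, Set.mem_toFinset]
  exact hcard ▸ sq_le_sum_planeCount hq hP hP'

/-- Whether two triples agree in at least two coordinates. -/
def agreeInTwo {q : ℕ} (u v : Fin q × Fin q × Fin q) : Bool :=
  (u.1 == v.1 && u.2.1 == v.2.1) || (u.1 == v.1 && u.2.2 == v.2.2) ||
    (u.2.1 == v.2.1 && u.2.2 == v.2.2)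

theorem agreeInTwo_iff {q : ℕ} {u v : Fin q × Fin q × Fin q} :
    agreeInTwo u v = true ↔ u ∈ closedNbhd (hammingCube q) v := by
  rw [mem_closedNbhd_hammingCube]
  simp [agreeInTwo, or_assoc]

set_option synthInstance.maxSize 2000 in
theorem four_le_card_of_binary_cube : ∀ S : Finset (Fin 2 × Fin 2 × Fin 2),
    (∀ u, u ∉ S → ∀ v, v ∉ S → u ≠ v →
      ∃ c ∈ S, agreeInTwo c u = true ∧ agreeInTwo c v = false) → 4 ≤ S.card := by
  decide +kernel

theorem four_le_ncard {C : Set (Fin 2 × Fin 2 × Fin 2)}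
    (hC : IsSolidLocDom (hammingCube 2) C) : 4 ≤ C.ncard := by
  classical
  rw [Set.ncard_eq_toFinset_card']
  refine four_le_card_of_binary_cube _ fun u hu v hv huv => ?_
  rw [Set.mem_toFinset] at hu hv
  obtain ⟨c, ⟨hcu, hcC⟩, hcv⟩ := hC u hu v hv huv
  exact ⟨c, Set.mem_toFinset.mpr hcC, agreeInTwo_iff.mpr hcu,
    Bool.eq_false_iff.mpr fun h => hcv ⟨agreeInTwo_iff.mp h, hcC⟩⟩

/-- For q ≥ 2: γ^DLD(K_q □ K_q □ K_q) = q². -/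
theorem gammaDLD_hammingCube (q : ℕ) (hq : 2 ≤ q) :
    gammaDLD (hammingCube q) = q ^ 2 := by
  have : NeZero q := ⟨by omega⟩
  refine IsLeast.csInf_eq ⟨⟨_, Set.range_nonempty _, isSolidLocDom_latin q, ?_⟩, ?_⟩
  · rw [← Set.image_univ, Set.ncard_image_of_injective _ (fun p r h => by
      simp only [Prod.mk.injEq] at h; exact Prod.ext h.1 h.2.1), Set.ncard_univ]
    simp [sq]
  · rintro k ⟨C, -, hC, rfl⟩
    rcases hq.eq_or_lt with rfl | hq
    · exact four_le_ncard hC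
    · exact sq_le_ncard_of_three_le hq hC
end
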